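/- Let P be a posterior-deterministic POMDP, f an SEC of P, and b an initial belief with S = supp(b) ∈ dom f. Let q, q' ∈ S be (f,S)-distinguishable, and let ρ be an observable run inside f from b such that both sequences (X_q^n(ρ))_{n∈ℕ} and (X_{q'}^n(ρ))_{n∈ℕ} converge, with limits X_q^∞(ρ) and X_{q'}^∞(ρ). If ρ distinguishes q and q' infinitely often, then at least one of X_q^∞(ρ) and X_{q'}^∞(ρ) equals 0. -/

import Mathlib

open scoped ENNReal BigOperators Classical
open Filter Topology

/-- A partially observable Markov decision process with finite state space `Q`,
finite action space `A` and finite observation space `O`.  `tr q a o q'` is the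
probability `T(o, q' | q, a)` of receiving observation `o` and moving to state `q'`
when taking action `a` in state `q`. -/
structure POMDP (Q A O : Type) [Fintype Q] [Fintype A] [Fintype O] where
  tr : Q → A → O → Q → ℝ≥0∞
  tr_sum_one : ∀ q a, (∑ o : O, ∑ q' : Q, tr q a o q') = 1

/-- An (observation-based) strategy: to each observable history it assigns a
probability distribution on actions. -/
structure Strategy (A O : Type) [Fintype A] where
  act : List (A × O) → A → ℝ≥0∞
  act_sum_one : ∀ h, (∑ a : A, act h a) = 1

/-- Support of a (sub-)belief. -/
noncomputable def beliefSupp {Q : Type} [Fintype Q] (b : Q → ℝ≥0∞) : Finset Q :=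
  Finset.univ.filter fun q => b q ≠ 0

/-- Dirac belief at a state. -/
noncomputable def dirac {Q : Type} (q : Q) : Q → ℝ≥0∞ := fun q' => if q' = q then 1 else 0

/-- Restriction of a (sub-)belief to a set of states. -/
noncomputable def restrictBel {Q : Type} (b : Q → ℝ≥0∞) (C : Finset Q) : Q → ℝ≥0∞ :=
  fun q => if q ∈ C then b q else 0

/-- The sequence of states visited by a history. -/
def statesOf {Q A O : Type} (q0 : Q) (l : List (A × O × Q)) : List Q :=
  q0 :: l.map fun x => x.2.2

/-- The observable projection of a history. -/
def obsOf {Q A O : Type} (l : List (A × O × Q)) : List (A × O) :=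
  l.map fun x => (x.1, x.2.1)

/-- A history hits the target set `Tset` for the first time at its last state. -/
def FirstHit {Q A O : Type} (Tset : Set Q) (q0 : Q) (l : List (A × O × Q)) : Prop :=
  (∃ q ∈ Tset, (statesOf q0 l).getLast? = some q) ∧
    ∀ q' ∈ (statesOf q0 l).dropLast, q' ∉ Tset

/-- The prefix of length `n` of an observable run. -/
def runPrefix {A O : Type} (ρ : ℕ → A × O) (n : ℕ) : List (A × O) :=
  List.ofFn fun i : Fin n => ρ i

namespace POMDP

variable {Q A O : Type} [Fintype Q] [Fintype A] [Fintype O]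

/-- Marginal probability `T(o | q, a)` of receiving observation `o`. -/
noncomputable def trO (P : POMDP Q A O) (q : Q) (a : A) (o : O) : ℝ≥0∞ := ∑ q' : Q, P.tr q a o q'

/-- A POMDP is posterior-deterministic if for every `(q, a, o)` there is at most one
successor state with positive probability. -/
def PostDet (P : POMDP Q A O) : Prop :=
  ∀ q a o q₁ q₂, P.tr q a o q₁ ≠ 0 → P.tr q a o q₂ ≠ 0 → q₁ = q₂

/-- The set of possible successors of `q` under action `a` and observation `o`
(in a posterior-deterministic POMDP, at most a singleton: `δ(q,a,o)`). -/
noncomputable def succs (P : POMDP Q A O) (q : Q) (a : A) (o : O) : Finset Q :=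
  Finset.univ.filter fun q' => P.tr q a o q' ≠ 0

/-- `δ(S, a, o)` on sets of states. -/
noncomputable def stepSet (P : POMDP Q A O) (S : Finset Q) (a : A) (o : O) : Finset Q :=
  S.biUnion fun q => P.succs q a o

/-- `δ*(S, h)` on sets of states along an observable history. -/
noncomputable def stepSetStar (P : POMDP Q A O) : Finset Q → List (A × O) → Finset Q
  | S, [] => S
  | S, (a, o) :: h => P.stepSetStar (P.stepSet S a o) h

/-- `T(o | b, a)`, the probability of observing `o` from (sub-)belief `b` after action `a`. -/
noncomputable def trOBel (P : POMDP Q A O) (b : Q → ℝ≥0∞) (a : A) (o : O) : ℝ≥0∞ :=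
  ∑ q : Q, b q * P.trO q a o

/-- Belief update `b_{a,o}`. -/
noncomputable def belStep (P : POMDP Q A O) (b : Q → ℝ≥0∞) (a : A) (o : O) : Q → ℝ≥0∞ :=
  fun q => (∑ q' : Q, b q' * P.tr q' a o q) / P.trOBel b a o

/-- Iterated belief update `δ*(b, h)` along an observable history. -/
noncomputable def belStepStar (P : POMDP Q A O) : (Q → ℝ≥0∞) → List (A × O) → Q → ℝ≥0∞
  | b, [] => b
  | b, (a, o) :: h => P.belStepStar (P.belStep b a o) h

/-- Probability of the continuation of a history under a strategy:
`runProbAux σ hist q l` is the probability, starting from state `q` after the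
observable history `hist`, that the next steps are exactly `l`. -/
noncomputable def runProbAux (P : POMDP Q A O) (σ : Strategy A O) :
    List (A × O) → Q → List (A × O × Q) → ℝ≥0∞
  | _, _, [] => 1
  | hist, q, (a, o, q') :: rest =>
      σ.act hist a * P.tr q a o q' * P.runProbAux σ (hist ++ [(a, o)]) q' rest

/-- Probability `P_b^σ(Cyl(q0, l))` of the cylinder of a history. -/
noncomputable def histProb (P : POMDP Q A O) (b : Q → ℝ≥0∞) (σ : Strategy A O)
    (q0 : Q) (l : List (A × O × Q)) : ℝ≥0∞ :=
  b q0 * P.runProbAux σ [] q0 l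

/-- Probability `P_b^σ(Reach(Tset))` of eventually visiting the target set:
the sum of cylinder probabilities over all histories hitting `Tset` for the first
time at their last state. -/
noncomputable def reachProb (P : POMDP Q A O) (Tset : Set Q) (b : Q → ℝ≥0∞)
    (σ : Strategy A O) : ℝ≥0∞ :=
  ∑' p : Q × List (A × O × Q), if FirstHit Tset p.1 p.2 then P.histProb b σ p.1 p.2 else 0

/-- The reachability value `Val(b) = sup_σ P_b^σ(Reach(Tset))`. -/
noncomputable def val (P : POMDP Q A O) (Tset : Set Q) (b : Q → ℝ≥0∞) : ℝ≥0∞ :=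
  ⨆ σ : Strategy A O, P.reachProb Tset b σ

/-- `Val(b, a) = Σ_o T(o | b, a) · Val(b_{a,o})`. -/
noncomputable def valAct (P : POMDP Q A O) (Tset : Set Q) (b : Q → ℝ≥0∞) (a : A) : ℝ≥0∞ :=
  ∑ o : O, P.trOBel b a o * P.val Tset (P.belStep b a o)

/-- A state is absorbing if once reached the system stays there forever. -/
def Absorbing (P : POMDP Q A O) (q : Q) : Prop :=
  ∀ a o q', P.tr q a o q' ≠ 0 → q' = q

/-- A state is observable if there is an observation received exactly when
entering this state. -/
def Observable (P : POMDP Q A O) (q : Q) : Prop :=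
  ∃ o : O, ∀ p a o' q', P.tr p a o' q' ≠ 0 → (q' = q ↔ o' = o)

/-- An observable history is inside a partial function `(dom, act)` from a support
`S`: every action taken is prescribed by `act` at the current support, which stays
in `dom`. -/
def InsideFrom (P : POMDP Q A O) (dom : Set (Finset Q)) (act : Finset Q → Finset A) :
    Finset Q → List (A × O) → Prop
  | _, [] => True
  | S, (a, o) :: h => S ∈ dom ∧ a ∈ act S ∧ InsideFrom P dom act (P.stepSet S a o) h

/-- A support end component (SEC): a partial function from nonempty belief supports
to nonempty sets of actions, closed under prescribed transitions and strongly
connected via prescribed histories. -/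
structure SEC (P : POMDP Q A O) where
  dom : Set (Finset Q)
  act : Finset Q → Finset A
  dom_nonempty : ∀ S ∈ dom, S.Nonempty
  act_nonempty : ∀ S ∈ dom, (act S).Nonempty
  closed : ∀ S ∈ dom, ∀ a ∈ act S, ∀ o : O, (P.stepSet S a o).Nonempty → P.stepSet S a o ∈ dom
  connected : ∀ S ∈ dom, ∀ S' ∈ dom,
      ∃ h : List (A × O), InsideFrom P dom act S h ∧ P.stepSetStar S h = S'

/-- `f` is contained in `f'`. -/
def SEC.Contained {P : POMDP Q A O} (f f' : SEC P) : Prop :=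
  f.dom ⊆ f'.dom ∧ ∀ S ∈ f.dom, f.act S ⊆ f'.act S

/-- A maximal SEC: any SEC containing it coincides with it. -/
def SEC.Maximal {P : POMDP Q A O} (f : SEC P) : Prop :=
  ∀ f' : SEC P, f.Contained f' → f'.dom = f.dom ∧ ∀ S ∈ f.dom, f'.act S = f.act S

/-- `(f, S)`-indistinguishability of two states `q, q' ∈ S`: along every history
inside `f` from `S`, the observation distributions from the (unique) successors of
`q` and `q'` agree for all prescribed actions. -/
def Indist (P : POMDP Q A O) (f : SEC P) (S : Finset Q) (q q' : Q) : Prop :=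
  ∀ h : List (A × O), InsideFrom P f.dom f.act S h →
    ∀ a ∈ f.act (P.stepSetStar S h), ∀ o : O,
      ∀ x ∈ P.stepSetStar {q} h, ∀ y ∈ P.stepSetStar {q'} h,
        P.trO x a o = P.trO y a o

/-- A distinguishing SEC. -/
def SEC.Distinguishing {P : POMDP Q A O} (f : SEC P) : Prop :=
  ∃ S ∈ f.dom, ∃ q ∈ S, ∃ q' ∈ S, ¬ Indist P f S q q'

/-- A non-distinguishing SEC. -/
def SEC.NonDistinguishing {P : POMDP Q A O} (f : SEC P) : Prop :=
  ∀ S ∈ f.dom, ∀ q ∈ S, ∀ q' ∈ S, Indist P f S q q'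

/-- The `(f,S)`-indistinguishability class of `q` inside `S`. -/
noncomputable def classOf (P : POMDP Q A O) (f : SEC P) (S : Finset Q) (q : Q) : Finset Q :=
  S.filter fun q' => Indist P f S q q'

/-- `Reach_f(b)`: the set of beliefs reachable from `b` by histories inside `f`. -/
def reachBel (P : POMDP Q A O) (f : SEC P) (b : Q → ℝ≥0∞) : Set (Q → ℝ≥0∞) :=
  {b' | ∃ h : List (A × O), InsideFrom P f.dom f.act (beliefSupp b) h ∧ P.belStepStar b h = b'}

/-- An observable run stays inside `f` from the support `S0`. -/
def RunInside (P : POMDP Q A O) (f : SEC P) (S0 : Finset Q) (ρ : ℕ → A × O) : Prop :=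
  ∀ n : ℕ, InsideFrom P f.dom f.act S0 (runPrefix ρ n)

/-- The a-posteriori probability `X_q^n(ρ) = δ*(b, ρ|_n)(δ*(q, ρ|_n))` of having
started in `q`, given the first `n` action-observation pairs of `ρ`. -/
noncomputable def Xpost (P : POMDP Q A O) (b : Q → ℝ≥0∞) (q : Q) (ρ : ℕ → A × O)
    (n : ℕ) : ℝ≥0∞ :=
  ∑ x ∈ P.stepSetStar {q} (runPrefix ρ n), P.belStepStar b (runPrefix ρ n) x

/-- A history `h = h' ++ [(a,o)]` distinguishes `q` and `q'`:
`T(o | δ*(q,h'), a) ≠ T(o | δ*(q',h'), a)`. -/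
def HistDistinguishes (P : POMDP Q A O) (q q' : Q) (h : List (A × O)) : Prop :=
  ∃ (h' : List (A × O)) (ao : A × O), h = h' ++ [ao] ∧
    (∑ x ∈ P.stepSetStar {q} h', P.trO x ao.1 ao.2) ≠
      (∑ x ∈ P.stepSetStar {q'} h', P.trO x ao.1 ao.2)

/-- The number of (nonempty) prefixes of `h` distinguishing `q` and `q'`. -/
noncomputable def distCount (P : POMDP Q A O) (q q' : Q) (h : List (A × O)) : ℕ :=
  ((Finset.range (h.length + 1)).filter fun i => P.HistDistinguishes q q' (h.take i)).card

/-- Probability `P_b^σ(Cyl(h))` of the cylinder of an observable history. -/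
noncomputable def obsCylProb (P : POMDP Q A O) (b : Q → ℝ≥0∞) (σ : Strategy A O)
    (h : List (A × O)) : ℝ≥0∞ :=
  ∑' p : Q × List (A × O × Q), if obsOf p.2 = h then P.histProb b σ p.1 p.2 else 0

/-- Probability `P_b^σ(initial state is q ∧ Cyl(h))`. -/
noncomputable def jointProb (P : POMDP Q A O) (b : Q → ℝ≥0∞) (σ : Strategy A O)
    (q : Q) (h : List (A × O)) : ℝ≥0∞ :=
  ∑' l : List (A × O × Q), if obsOf l = h then P.histProb b σ q l else 0

/-- `X_q^n` evaluated on the `F_n`-atom of the observable history `h`: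
the conditional probability of having started in `q` given `Cyl(h)`. -/
noncomputable def condX (P : POMDP Q A O) (b : Q → ℝ≥0∞) (σ : Strategy A O)
    (q : Q) (h : List (A × O)) : ℝ≥0∞ :=
  P.jointProb b σ q h / P.obsCylProb b σ h

/-- Probability `P_b^σ(∃ prefix whose observable history satisfies E)`: the sum of
cylinder probabilities over histories satisfying `E` for the first time. -/
noncomputable def eventProb (P : POMDP Q A O) (b : Q → ℝ≥0∞) (σ : Strategy A O)
    (E : List (A × O) → Prop) : ℝ≥0∞ :=
  ∑' p : Q × List (A × O × Q),
    if E (obsOf p.2) ∧ ∀ l' : List (A × O × Q), l' <+: p.2 → l' ≠ p.2 → ¬ E (obsOf l')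
    then P.histProb b σ p.1 p.2 else 0

/-- The set of actions used by the uniform strategy of an SEC `f` after an
observable history (the prescribed actions if the current support has some,
all actions otherwise). -/
noncomputable def unifSupport (P : POMDP Q A O) (f : SEC P) (S0 : Finset Q)
    (h : List (A × O)) : Finset A :=
  if (f.act (P.stepSetStar S0 h)).Nonempty then f.act (P.stepSetStar S0 h) else Finset.univ

theorem unifSupport_nonempty [Nonempty A] (P : POMDP Q A O) (f : SEC P) (S0 : Finset Q)
    (h : List (A × O)) : (P.unifSupport f S0 h).Nonempty := by
  unfold unifSupport
  split
  · assumption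
  · exact Finset.univ_nonempty

/-- The uniform strategy `unif_f`: it tracks the current belief support and picks a
prescribed action uniformly at random. -/
noncomputable def unifStrat [Nonempty A] (P : POMDP Q A O) (f : SEC P) (S0 : Finset Q) :
    Strategy A O where
  act h a := if a ∈ P.unifSupport f S0 h then ((P.unifSupport f S0 h).card : ℝ≥0∞)⁻¹ else 0
  act_sum_one := by
    intro h
    have hne := P.unifSupport_nonempty f S0 h
    rw [Finset.sum_ite_mem, Finset.univ_inter, Finset.sum_const, nsmul_eq_mul,
      ENNReal.mul_inv_cancel]
    · exact Nat.cast_ne_zero.mpr (Finset.card_ne_zero.mpr hne)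
    · exact ENNReal.natCast_ne_top _

end POMDP
namespace POMDP

variable {Q A O : Type} [Fintype Q] [Fintype A] [Fintype O]

theorem runPrefix_succ' {A O : Type} (ρ : ℕ → A × O) (n : ℕ) :
    runPrefix ρ (n + 1) = runPrefix ρ n ++ [ρ n] := by
  unfold runPrefix
  rw [List.ofFn_succ', List.concat_eq_append]
  simp

theorem stepSetStar_append (P : POMDP Q A O) (h : List (A × O)) (p : A × O) :
    ∀ S : Finset Q, P.stepSetStar S (h ++ [p]) = P.stepSet (P.stepSetStar S h) p.1 p.2 := by
  induction h with
  | nil => intro S; rfl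
  | cons c h ih => intro S; exact ih _

theorem belStepStar_append (P : POMDP Q A O) (h : List (A × O)) (p : A × O) :
    ∀ b : Q → ℝ≥0∞, P.belStepStar b (h ++ [p]) = P.belStep (P.belStepStar b h) p.1 p.2 := by
  induction h with
  | nil => intro S; rfl
  | cons c h ih => intro S; exact ih _

theorem trO_le_one (P : POMDP Q A O) (q : Q) (a : A) (o : O) : P.trO q a o ≤ 1 := by
  rw [← P.tr_sum_one q a]
  exact Finset.single_le_sum (f := fun o => ∑ q' : Q, P.tr q a o q') (fun _ _ => zero_le)
    (Finset.mem_univ o)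

theorem belStep_sum_le (P : POMDP Q A O) (b : Q → ℝ≥0∞) (a : A) (o : O) :
    ∑ x, P.belStep b a o x ≤ 1 := by
  have : ∑ x, P.belStep b a o x = P.trOBel b a o / P.trOBel b a o := by
    simp only [belStep, div_eq_mul_inv]
    rw [← Finset.sum_mul, Finset.sum_comm]
    congr 1
    simp only [trOBel, trO, Finset.mul_sum]
  rw [this]
  exact ENNReal.div_self_le_one

theorem belStepStar_sum_le (P : POMDP Q A O) (h : List (A × O)) :
    ∀ b : Q → ℝ≥0∞, ∑ x, b x ≤ 1 → ∑ x, P.belStepStar b h x ≤ 1 := by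
  induction h with
  | nil => intro b hb; exact hb
  | cons c h ih => intro b _; exact ih _ (P.belStep_sum_le b c.1 c.2)

theorem trOBel_le_one (P : POMDP Q A O) (b : Q → ℝ≥0∞) (hb : ∑ x, b x ≤ 1) (a : A) (o : O) :
    P.trOBel b a o ≤ 1 := by
  refine le_trans (Finset.sum_le_sum fun x _ => ?_) hb
  exact mul_le_of_le_one_right zero_le (P.trO_le_one x a o)

theorem exists_pred (P : POMDP Q A O) (b : Q → ℝ≥0∞) (a : A) (o : O) (x : Q)
    (hx : x ∈ beliefSupp (P.belStep b a o)) : ∃ z ∈ beliefSupp b, P.tr z a o x ≠ 0 := by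
  by_contra hcon
  push Not at hcon
  simp only [beliefSupp, Finset.mem_filter, Finset.mem_univ, true_and] at hx hcon
  apply hx
  have : (∑ q' : Q, b q' * P.tr q' a o x) = 0 := by
    refine Finset.sum_eq_zero fun z _ => ?_
    by_cases hz : b z = 0
    · simp [hz]
    · simp [hcon z hz]
  simp [belStep, this]

theorem card_supp_le (P : POMDP Q A O) (hP : P.PostDet) (b : Q → ℝ≥0∞) (a : A) (o : O) :
    (beliefSupp (P.belStep b a o)).card ≤ (beliefSupp b).card := by
  choose! g hg hg' using P.exists_pred b a o
  refine Finset.card_le_card_of_injOn g (fun x hx => hg x hx) ?_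
  intro x hx y hy hxy
  have h1 := hg' x hx
  have h2 := hg' y hy
  rw [hxy] at h1
  exact hP _ _ _ _ _ h1 h2

theorem pred_unique (P : POMDP Q A O) (hP : P.PostDet) (b : Q → ℝ≥0∞) (a : A) (o : O)
    (hc : (beliefSupp (P.belStep b a o)).card = (beliefSupp b).card)
    (x z z' : Q) (hz : z ∈ beliefSupp b)
    (hz' : z' ∈ beliefSupp b) (h : P.tr z a o x ≠ 0) (h' : P.tr z' a o x ≠ 0) : z = z' := by
  choose! g hg hg' using P.exists_pred b a o
  have hinj : Set.InjOn g (beliefSupp (P.belStep b a o)) := by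
    intro x hx y hy hxy
    have h1 := hg' x hx
    have h2 := hg' y hy
    rw [hxy] at h1
    exact hP _ _ _ _ _ h1 h2
  have hsurj := Finset.surjOn_of_injOn_of_card_le g (fun x hx => hg x hx) hinj hc.ge
  obtain ⟨w, hw, rfl⟩ := hsurj hz
  obtain ⟨w', hw', rfl⟩ := hsurj hz'
  have e := hP _ _ _ _ _ (hg' w hw) h
  have e' := hP _ _ _ _ _ (hg' w' hw') h'
  rw [e, e']

theorem stepSetStar_subsingleton (P : POMDP Q A O) (hP : P.PostDet) (h : List (A × O)) :
    ∀ S : Finset Q, (∀ x ∈ S, ∀ y ∈ S, x = y) →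
      ∀ x ∈ P.stepSetStar S h, ∀ y ∈ P.stepSetStar S h, x = y := by
  induction h with
  | nil => intro S hS; exact hS
  | cons c h ih =>
    intro S hS
    refine ih _ ?_
    intro x hx y hy
    simp only [stepSet, succs, Finset.mem_biUnion, Finset.mem_filter, Finset.mem_univ,
      true_and] at hx hy
    obtain ⟨z, hz, hzx⟩ := hx
    obtain ⟨w, hw, hwy⟩ := hy
    rw [hS w hw z hz] at hwy
    exact hP _ _ _ _ _ hzx hwy

theorem trO_eq (P : POMDP Q A O) (hP : P.PostDet) (z : Q) (a : A) (o : O) (x : Q)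
    (h : P.tr z a o x ≠ 0) : P.trO z a o = P.tr z a o x := by
  unfold trO
  refine Finset.sum_eq_single x (fun y _ hy => ?_) (by simp)
  by_contra hne
  exact hy (hP _ _ _ _ _ hne h)

/-- One step of the posterior recursion, when the support size stays constant. -/
theorem step_eq (P : POMDP Q A O) (hP : P.PostDet) (b : Q → ℝ≥0∞) (hb : ∑ x, b x ≤ 1)
    (a : A) (o : O)
    (hc : (beliefSupp (P.belStep b a o)).card = (beliefSupp b).card)
    (D : Finset Q) (hD : ∀ x ∈ D, ∀ y ∈ D, x = y)
    (h0 : ∑ x ∈ D, b x ≠ 0)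
    (h1 : ∑ x ∈ P.stepSet D a o, P.belStep b a o x ≠ 0) :
    P.trOBel b a o ≠ 0 ∧
    (∑ x ∈ P.stepSet D a o, P.belStep b a o x) * P.trOBel b a o =
      (∑ x ∈ D, b x) * ∑ x ∈ D, P.trO x a o := by
  obtain ⟨z, hzD, hz⟩ := Finset.exists_ne_zero_of_sum_ne_zero h0
  obtain ⟨x, hxD, hx⟩ := Finset.exists_ne_zero_of_sum_ne_zero h1
  have eD : D = {z} := Finset.eq_singleton_iff_unique_mem.2 ⟨hzD, fun y hy => hD y hy z hzD⟩
  subst eD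
  simp only [stepSet, succs, Finset.singleton_biUnion, Finset.mem_filter, Finset.mem_univ,
    true_and] at hxD
  have eS : P.stepSet {z} a o = {x} := by
    refine Finset.eq_singleton_iff_unique_mem.2 ⟨by simpa [stepSet, succs] using hxD, ?_⟩
    intro y hy
    simp only [stepSet, succs, Finset.singleton_biUnion, Finset.mem_filter, Finset.mem_univ,
      true_and] at hy
    exact hP _ _ _ _ _ hy hxD
  have htop : P.trOBel b a o ≠ ⊤ :=
    ne_top_of_le_ne_top ENNReal.one_ne_top (P.trOBel_le_one b hb a o)
  have hnum : ∑ q' : Q, b q' * P.tr q' a o x = b z * P.tr z a o x := by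
    refine Finset.sum_eq_single z (fun y _ hy => ?_) (by simp)
    by_contra hne
    have h2 : b y ≠ 0 := left_ne_zero_of_mul hne
    have h3 : P.tr y a o x ≠ 0 := right_ne_zero_of_mul hne
    exact hy (P.pred_unique hP b a o hc x y z (by simp [beliefSupp, h2])
      (by simp [beliefSupp, hz]) h3 hxD)
  have hne : P.trOBel b a o ≠ 0 := by
    intro h
    have := (Finset.sum_eq_zero_iff.1 h) z (Finset.mem_univ z)
    rw [P.trO_eq hP z a o x hxD] at this
    exact (mul_ne_zero hz hxD) this
  refine ⟨hne, ?_⟩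
  rw [eS, Finset.sum_singleton, Finset.sum_singleton, Finset.sum_singleton,
    P.trO_eq hP z a o x hxD, ← hnum, belStep, ENNReal.div_mul_cancel hne htop]

end POMDP

/-- In a posterior-deterministic POMDP, along an observable run
`ρ` inside an SEC `f` from `b`, if `ρ` distinguishes two `(f,S)`-distinguishable
states `q, q' ∈ S = supp(b)` infinitely often and the posterior sequences converge,
then at least one of the limits is `0`. -/
theorem stmt16 {Q A O : Type} [Fintype Q] [Fintype A] [Fintype O]
    (P : POMDP Q A O) (hP : P.PostDet)
    (f : POMDP.SEC P)
    (b : Q → ℝ≥0∞) (hb : (∑ q : Q, b q) = 1) (hS : beliefSupp b ∈ f.dom)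
    (q q' : Q) (hq : q ∈ beliefSupp b) (hq' : q' ∈ beliefSupp b)
    (hdist : ¬ POMDP.Indist P f (beliefSupp b) q q')
    (ρ : ℕ → A × O) (hρ : POMDP.RunInside P f (beliefSupp b) ρ)
    (Lq Lq' : ℝ≥0∞)
    (hLq : Filter.Tendsto (P.Xpost b q ρ) Filter.atTop (nhds Lq))
    (hLq' : Filter.Tendsto (P.Xpost b q' ρ) Filter.atTop (nhds Lq'))
    (hio : {n : ℕ | P.HistDistinguishes q q' (runPrefix ρ n)}.Infinite) :
    Lq = 0 ∨ Lq' = 0 := by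
  by_contra hcon
  push Not at hcon
  obtain ⟨hL, hL'⟩ := hcon
  have hbs : ∀ n, ∑ x, P.belStepStar b (runPrefix ρ n) x ≤ 1 := fun n =>
    P.belStepStar_sum_le _ b hb.le
  have hX1 : ∀ r n, P.Xpost b r ρ n ≤ 1 := fun r n =>
    (Finset.sum_le_sum_of_subset (Finset.subset_univ _)).trans (hbs n)
  have hLt : Lq ≠ ⊤ := ne_top_of_le_ne_top ENNReal.one_ne_top
    (le_of_tendsto' hLq (hX1 q))
  have hLt' : Lq' ≠ ⊤ := ne_top_of_le_ne_top ENNReal.one_ne_top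
    (le_of_tendsto' hLq' (hX1 q'))
  -- support sizes are eventually constant
  let c : ℕ → ℕ := fun n => (beliefSupp (P.belStepStar b (runPrefix ρ n))).card
  have hcanti : Antitone c := by
    refine antitone_nat_of_succ_le fun n => ?_
    simp only [c]
    rw [POMDP.runPrefix_succ', P.belStepStar_append]
    exact P.card_supp_le hP _ _ _
  obtain ⟨N, hN⟩ : ∃ N, ∀ n, N ≤ n → c n = c N := by
    obtain ⟨N, hN⟩ := WellFounded.has_min (wellFounded_lt (α := ℕ)) (Set.range c) ⟨_, 0, rfl⟩
    obtain ⟨⟨N, rfl⟩, hmin⟩ := hN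
    exact ⟨N, fun n hn => le_antisymm (hcanti hn) (not_lt.1 (hmin _ ⟨n, rfl⟩))⟩
  let D : Q → ℕ → Finset Q := fun r n => P.stepSetStar {r} (runPrefix ρ n)
  let t : Finset Q → A × O → ℝ≥0∞ := fun E p => ∑ x ∈ E, P.trO x p.1 p.2
  have hstep : ∀ r n, N ≤ n → P.Xpost b r ρ n ≠ 0 → P.Xpost b r ρ (n + 1) ≠ 0 →
      P.trOBel (P.belStepStar b (runPrefix ρ n)) (ρ n).1 (ρ n).2 ≠ 0 ∧
      P.Xpost b r ρ (n + 1) * P.trOBel (P.belStepStar b (runPrefix ρ n)) (ρ n).1 (ρ n).2 =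
        P.Xpost b r ρ n * t (D r n) (ρ n) := by
    intro r n hn h0 h1
    have hc : c (n + 1) = c n := (hN _ (by omega)).trans (hN n hn).symm
    simp only [c] at hc
    unfold POMDP.Xpost at h0 h1 ⊢
    rw [POMDP.runPrefix_succ', P.belStepStar_append] at hc h1 ⊢
    rw [P.stepSetStar_append] at h1 ⊢
    exact P.step_eq hP _ (hbs n) _ _ hc _
      (P.stepSetStar_subsingleton hP _ _ (by simp)) h0 h1
  have hev : ∀ r L, Tendsto (P.Xpost b r ρ) atTop (𝓝 L) → L ≠ 0 →
      ∀ᶠ n in atTop, P.Xpost b r ρ n ≠ 0 ∧ P.Xpost b r ρ (n + 1) ≠ 0 := by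
    intro r L h hL
    have := h.eventually_ne hL
    exact this.and ((tendsto_add_atTop_nat 1).eventually this)
  have hcross : ∀ᶠ n in atTop,
      P.Xpost b q ρ (n + 1) * P.Xpost b q' ρ n * t (D q' n) (ρ n) =
      P.Xpost b q' ρ (n + 1) * P.Xpost b q ρ n * t (D q n) (ρ n) := by
    filter_upwards [hev q Lq hLq hL, hev q' Lq' hLq' hL', eventually_ge_atTop N]
      with n h1 h2 hn
    obtain ⟨hc, e1⟩ := hstep q n hn h1.1 h1.2
    obtain ⟨-, e2⟩ := hstep q' n hn h2.1 h2.2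
    have hct : P.trOBel (P.belStepStar b (runPrefix ρ n)) (ρ n).1 (ρ n).2 ≠ ⊤ :=
      ne_top_of_le_ne_top ENNReal.one_ne_top (P.trOBel_le_one _ (hbs n) _ _)
    rw [← ENNReal.mul_left_inj hc hct]
    calc _ = (P.Xpost b q ρ (n + 1) *
            P.trOBel (P.belStepStar b (runPrefix ρ n)) (ρ n).1 (ρ n).2) *
            (P.Xpost b q' ρ n * t (D q' n) (ρ n)) := by ring
      _ = (P.Xpost b q' ρ (n + 1) *
            P.trOBel (P.belStepStar b (runPrefix ρ n)) (ρ n).1 (ρ n).2) *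
            (P.Xpost b q ρ n * t (D q n) (ρ n)) := by rw [e1, e2]; ring
      _ = _ := by ring
  have htt : ∀ (E : Finset Q) (p : A × O), t E p ≠ ⊤ := fun E p =>
    ENNReal.sum_ne_top.2 fun x _ =>
      ne_top_of_le_ne_top ENNReal.one_ne_top (P.trO_le_one x _ _)
  have hkey : ∀ᶠ n in atTop, ∀ v : Finset Q × Finset Q × (A × O),
      t v.1 v.2.2 ≠ t v.2.1 v.2.2 → (D q n, D q' n, ρ n) ≠ v := by
    rw [eventually_all]
    rintro ⟨E, E', p⟩
    by_contra hf
    have hfr : ∃ᶠ n in atTop, t E p ≠ t E' p ∧ (D q n, D q' n, ρ n) = (E, E', p) := by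
      refine (Filter.not_eventually.1 hf).mono fun n hn => ?_
      push Not at hn
      exact hn
    obtain ⟨_, hne, -⟩ := hfr.exists
    have hs := hLq.comp (tendsto_add_atTop_nat 1)
    have hs' := hLq'.comp (tendsto_add_atTop_nat 1)
    have l1 : Tendsto (fun n => P.Xpost b q ρ (n + 1) * P.Xpost b q' ρ n * t E' p) atTop
        (𝓝 (Lq * Lq' * t E' p)) :=
      ENNReal.Tendsto.mul_const (ENNReal.Tendsto.mul hs (.inl hL) hLq' (.inl hL'))
        (.inr (htt _ _))
    have l2 : Tendsto (fun n => P.Xpost b q' ρ (n + 1) * P.Xpost b q ρ n * t E p) atTop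
        (𝓝 (Lq' * Lq * t E p)) :=
      ENNReal.Tendsto.mul_const (ENNReal.Tendsto.mul hs' (.inl hL') hLq (.inl hL))
        (.inr (htt _ _))
    have heq := tendsto_nhds_unique_of_frequently_eq l1 l2
      ((hfr.and_eventually hcross).mono fun n hn => by
        obtain ⟨⟨-, h1⟩, h2⟩ := hn
        simp only [Prod.mk.injEq] at h1
        obtain ⟨rfl, rfl, rfl⟩ := h1
        exact h2)
    rw [mul_comm Lq' Lq, ENNReal.mul_right_inj (mul_ne_zero hL hL')
      (ENNReal.mul_ne_top hLt hLt')] at heq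
    exact hne heq.symm
  obtain ⟨M, hM⟩ := eventually_atTop.1 hkey
  obtain ⟨n, hn, hnM⟩ := hio.exists_gt M
  obtain ⟨h', ao, e, hne⟩ := hn
  obtain ⟨m, rfl⟩ : ∃ m, n = m + 1 := ⟨n - 1, by omega⟩
  rw [POMDP.runPrefix_succ'] at e
  obtain ⟨rfl, e2⟩ := List.append_inj' e rfl
  simp only [List.cons.injEq, and_true] at e2
  subst e2
  exact hM m (by omega) (D q m, D q' m, ρ m) hne rfl
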